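/- arXiv:2005.08059 — 2 statements merged into one kernel-verified Lean document; each statement's English description precedes it below -/
import Mathlib

section
/- Let H be a real Hilbert space, let V be a Hilbert space densely and continuously embedded in H, and let a : V × V → ℝ be bilinear, continuous and essentially positive-coercive. Then (a, V) is a closed form (in particular a is elliptic), and the C₀-semigroup S on H associated with (a, V) is asymptotically compact, i.e. ‖S(t)‖_ess → 0 as t → ∞. -/
open Filter Topology Set
open scoped RealInnerProductSpace

/-- The essential norm of a continuous linear operator:
the distance to the space of compact operators. -/
noncomputable def essNorm {E : Type*} [NormedAddCommGroup E] [NormedSpace ℝ E]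
    (R : E →L[ℝ] E) : ℝ :=
  sInf {c : ℝ | ∃ K : E →L[ℝ] E, IsCompactOperator ⇑K ∧ c = ‖R - K‖}

/-- If every finite-codimensional closed subspace contains unit vectors satisfying `Q n`, for
arbitrary `n`, then such vectors can be chosen to form an orthonormal sequence. -/
theorem exists_orthonormal_seq_of_forall_finiteDimensional
    {E : Type*} [NormedAddCommGroup E] [InnerProductSpace ℝ E] (Q : ℕ → E → Prop)
    (h : ∀ (n : ℕ) (F : Submodule ℝ E), FiniteDimensional ℝ F → ∃ x ∈ Fᗮ, ‖x‖ = 1 ∧ Q n x) :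
    ∃ (k : ℕ → ℕ) (u : ℕ → E), StrictMono k ∧ Orthonormal ℝ u ∧ ∀ n, Q (k n) (u n) := by
  classical
  obtain ⟨f, hf, hr⟩ := exists_seq_of_forall_finset_exists
    (fun p : ℕ × E => ‖p.2‖ = 1 ∧ Q p.1 p.2) (fun p q => p.1 < q.1 ∧ ⟪p.2, q.2⟫ = 0) (by
      intro s _
      obtain ⟨x, hx, hx1, hxQ⟩ := h (s.sup Prod.fst + 1)
        (Submodule.span ℝ (s.image Prod.snd : Set E)) (by
          rw [Finset.coe_image]
          exact FiniteDimensional.span_of_finite ℝ (s.finite_toSet.image _))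
      refine ⟨(s.sup Prod.fst + 1, x), ⟨hx1, hxQ⟩, fun p hp => ⟨?_, ?_⟩⟩
      · exact Nat.lt_succ_of_le (Finset.le_sup (f := Prod.fst) hp)
      · exact (Submodule.mem_orthogonal _ _).1 hx _
          (Submodule.subset_span (by simpa using ⟨p.1, hp⟩)))
  refine ⟨fun n => (f n).1, fun n => (f n).2, fun m n hmn => (hr m n hmn).1,
    ⟨fun n => (hf n).1, fun m n hmn => ?_⟩, fun n => (hf n).2⟩
  rcases lt_or_gt_of_ne hmn with h' | h'
  · exact (hr m n h').2
  · rw [real_inner_comm]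
    exact (hr n m h').2

theorem Orthonormal.tendsto_inner_zero
    {E : Type*} [NormedAddCommGroup E] [InnerProductSpace ℝ E] {u : ℕ → E}
    (hu : Orthonormal ℝ u) (x : E) : Tendsto (fun n => ⟪u n, x⟫) atTop (𝓝 0) := by
  have h := (hu.inner_products_summable x).tendsto_atTop_zero
  rw [tendsto_zero_iff_norm_tendsto_zero]
  simpa [Real.sqrt_sq_eq_abs] using h.sqrt

theorem exists_finiteDimensional_coercive_on_orthogonal
    {V : Type*} [NormedAddCommGroup V] [InnerProductSpace ℝ V]
    (a : V →ₗ[ℝ] V →ₗ[ℝ] ℝ)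
    (hepc : ∀ u : ℕ → V,
      (∀ v : V, Tendsto (fun n : ℕ => ⟪u n, v⟫) atTop (𝓝 0)) →
      (∀ ε : ℝ, 0 < ε → ∀ᶠ n : ℕ in atTop, a (u n) (u n) ≤ ε) →
      Tendsto (fun n : ℕ => ‖u n‖) atTop (𝓝 0)) :
    ∃ (F : Submodule ℝ V) (α : ℝ), FiniteDimensional ℝ F ∧ 0 < α ∧
      ∀ u ∈ Fᗮ, α * ‖u‖ ^ 2 ≤ a u u := by
  by_contra! hcon
  obtain ⟨k, u, hk, hu, hQ⟩ := exists_orthonormal_seq_of_forall_finiteDimensional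
    (fun n x => a x x < 1 / ((n : ℝ) + 1)) (by
      intro n F hF
      obtain ⟨x, hx, hlt⟩ := hcon F (1 / ((n : ℝ) + 1)) hF (by positivity)
      have hx0 : x ≠ 0 := by
        rintro rfl
        simp at hlt
      have hpos : 0 < ‖x‖ := norm_pos_iff.2 hx0
      refine ⟨‖x‖⁻¹ • x, Fᗮ.smul_mem _ hx, by
        rw [norm_smul, norm_inv, norm_norm, inv_mul_cancel₀ hpos.ne'], ?_⟩
      have : a (‖x‖⁻¹ • x) (‖x‖⁻¹ • x) = a x x / ‖x‖ ^ 2 := by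
        simp only [map_smul, LinearMap.smul_apply, smul_eq_mul]
        field_simp
      rw [this, div_lt_iff₀ (by positivity)]
      exact hlt)
  have h0 := hepc u hu.tendsto_inner_zero (by
    intro ε hε
    have ht := (tendsto_one_div_add_atTop_nhds_zero_nat (𝕜 := ℝ)).comp hk.tendsto_atTop
    filter_upwards [ht.eventually_lt_const hε] with n hn
    exact (hQ n).le.trans hn.le)
  simp only [hu.1] at h0
  exact one_ne_zero (tendsto_nhds_unique tendsto_const_nhds h0)

theorem denseRange_adjoint_of_injective
    {H : Type*} [NormedAddCommGroup H] [InnerProductSpace ℝ H] [CompleteSpace H]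
    {V : Type*} [NormedAddCommGroup V] [InnerProductSpace ℝ V] [CompleteSpace V]
    (ι : V →L[ℝ] H) (hinj : Function.Injective ι) :
    DenseRange (ContinuousLinearMap.adjoint ι) := by
  have h := ι.orthogonal_ker
  rw [show ι.ker = ⊥ from LinearMap.ker_eq_bot.2 hinj, Submodule.bot_orthogonal_eq_top] at h
  exact Submodule.dense_iff_topologicalClosure_eq_top.2 h.symm

/-- An essentially positive-coercive form becomes coercive after adding a finite-rank
perturbation coming from `H`. -/
theorem exists_finite_rank_coercive
    {H : Type*} [NormedAddCommGroup H] [InnerProductSpace ℝ H] [CompleteSpace H]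
    {V : Type*} [NormedAddCommGroup V] [InnerProductSpace ℝ V] [CompleteSpace V]
    (ι : V →L[ℝ] H) (hinj : Function.Injective ι)
    (a : V →ₗ[ℝ] V →ₗ[ℝ] ℝ)
    (hcont : ∃ M : ℝ, ∀ u v : V, |a u v| ≤ M * ‖u‖ * ‖v‖)
    (hepc : ∀ u : ℕ → V,
      (∀ v : V, Tendsto (fun n : ℕ => ⟪u n, v⟫) atTop (𝓝 0)) →
      (∀ ε : ℝ, 0 < ε → ∀ᶠ n : ℕ in atTop, a (u n) (u n) ≤ ε) →
      Tendsto (fun n : ℕ => ‖u n‖) atTop (𝓝 0)) :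
    ∃ (N : ℕ) (h : Fin N → H) (c α : ℝ), 0 ≤ c ∧ 0 < α ∧
      ∀ u : V, α * ‖u‖ ^ 2 ≤ a u u + c * ∑ i, ⟪h i, ι u⟫ ^ 2 := by
  obtain ⟨M₀, hM₀⟩ := hcont
  obtain ⟨M, hM0, hM⟩ : ∃ M : ℝ, 0 ≤ M ∧ ∀ u v : V, |a u v| ≤ M * ‖u‖ * ‖v‖ :=
    ⟨max M₀ 0, le_max_right _ _, fun u v => (hM₀ u v).trans (by gcongr; exact le_max_left _ _)⟩
  obtain ⟨F, α, hF, hα, hco⟩ := exists_finiteDimensional_coercive_on_orthogonal a hepc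
  set N := Module.finrank ℝ F
  let e := stdOrthonormalBasis ℝ F
  set C : ℝ := α + M + 2 * M ^ 2 / α with hC
  have hC0 : 0 < C := by positivity
  -- coercivity up to the orthogonal projection onto `F`
  have hproj : ∀ u : V, α / 2 * ‖u‖ ^ 2 ≤ a u u + C * ‖F.starProjection u‖ ^ 2 := by
    intro u
    set p := F.starProjection u
    set q := Fᗮ.starProjection u
    have hu : u = p + q := (F.starProjection_add_starProjection_orthogonal u).symm
    have hn : ‖u‖ ^ 2 = ‖p‖ ^ 2 + ‖q‖ ^ 2 := F.norm_sq_eq_add_norm_sq_starProjection u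
    have hq := hco q (Fᗮ.starProjection_apply_mem u)
    have h1 := neg_le_of_abs_le (hM p p)
    have h2 := neg_le_of_abs_le (hM p q)
    have h3 := neg_le_of_abs_le (hM q p)
    have hexp : a u u = a p p + a p q + (a q p + a q q) := by
      rw [hu]; simp only [map_add, LinearMap.add_apply]; ring
    have h4 : 2 * M * ‖p‖ * ‖q‖ ≤ α / 2 * ‖q‖ ^ 2 + 2 * M ^ 2 / α * ‖p‖ ^ 2 := by
      have : α / 2 * ‖q‖ ^ 2 + 2 * M ^ 2 / α * ‖p‖ ^ 2 - 2 * M * ‖p‖ * ‖q‖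
          = (α * ‖q‖ - 2 * M * ‖p‖) ^ 2 / (2 * α) := by
        field_simp; ring
      have : 0 ≤ (α * ‖q‖ - 2 * M * ‖p‖) ^ 2 / (2 * α) := by positivity
      linarith
    have h5 : 0 ≤ α / 2 * ‖p‖ ^ 2 := by positivity
    rw [hexp, hn, hC]
    nlinarith
  have hsum : ∀ u : V, ‖F.starProjection u‖ ^ 2 = ∑ i, ⟪(e i : V), u⟫ ^ 2 := by
    intro u
    rw [F.starProjection_apply, ← Submodule.coe_norm, ← e.sum_sq_inner_right]
    exact Finset.sum_congr rfl fun i _ => by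
      rw [F.inner_orthogonalProjectionOnto_eq_of_mem_left]
  obtain ⟨η, hη, hηN⟩ : ∃ η : ℝ, 0 < η ∧ C * (N * (2 * η ^ 2)) ≤ α / 4 := by
    refine ⟨√(α / (8 * C * (N + 1))), by positivity, ?_⟩
    rw [Real.sq_sqrt (by positivity)]
    have : C * (N * (2 * (α / (8 * C * (N + 1))))) = α / 4 * (N / (N + 1)) := by
      field_simp; ring
    rw [this]
    exact mul_le_of_le_one_right (by positivity) ((div_le_one (by positivity)).2 (by linarith))
  choose h hh using fun i => (denseRange_adjoint_of_injective ι hinj).exists_dist_lt (e i : V) hη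
  refine ⟨N, h, 2 * C, α / 4, by positivity, by positivity, fun u => ?_⟩
  have hi : ∀ i, ⟪(e i : V), u⟫ ^ 2 ≤ 2 * ⟪h i, ι u⟫ ^ 2 + 2 * η ^ 2 * ‖u‖ ^ 2 := by
    intro i
    set d := (e i : V) - ContinuousLinearMap.adjoint ι (h i)
    have hd : ‖d‖ ≤ η := by rw [← dist_eq_norm]; exact (hh i).le
    have h1 : ⟪(e i : V), u⟫ = ⟪d, u⟫ + ⟪h i, ι u⟫ := by
      rw [← ContinuousLinearMap.adjoint_inner_left, ← inner_add_left, sub_add_cancel]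
    have h2 : ⟪d, u⟫ ^ 2 ≤ η ^ 2 * ‖u‖ ^ 2 := by
      rw [← mul_pow]
      exact sq_le_sq.2 ((abs_real_inner_le_norm d u).trans (by
        rw [abs_of_nonneg (by positivity)]; gcongr))
    rw [h1]
    nlinarith [sq_nonneg (⟪d, u⟫ - ⟪h i, ι u⟫)]
  have hs : ‖F.starProjection u‖ ^ 2
      ≤ 2 * ∑ i, ⟪h i, ι u⟫ ^ 2 + N * (2 * η ^ 2 * ‖u‖ ^ 2) := by
    rw [hsum u]
    refine (Finset.sum_le_sum fun i _ => hi i).trans_eq ?_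
    rw [Finset.sum_add_distrib, ← Finset.mul_sum]
    simp [N]
  have h1 := hproj u
  have h2 := mul_le_mul_of_nonneg_left hs hC0.le
  have h3 := mul_le_mul_of_nonneg_right hηN (sq_nonneg ‖u‖)
  nlinarith

theorem essNorm_nonneg {E : Type*} [NormedAddCommGroup E] [NormedSpace ℝ E] (R : E →L[ℝ] E) :
    0 ≤ essNorm R :=
  Real.sInf_nonneg fun _ ⟨_, _, hc⟩ => hc ▸ norm_nonneg _

theorem essNorm_le_norm_sub {E : Type*} [NormedAddCommGroup E] [NormedSpace ℝ E]
    (R K : E →L[ℝ] E) (hK : IsCompactOperator K) : essNorm R ≤ ‖R - K‖ :=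
  csInf_le ⟨0, fun _ ⟨_, _, hc⟩ => hc ▸ norm_nonneg _⟩ ⟨K, hK, rfl⟩

theorem essNorm_le_of_forall_orthonormal
    {E : Type*} [NormedAddCommGroup E] [InnerProductSpace ℝ E] (R : E →L[ℝ] E) {c : ℝ}
    (hc : 0 ≤ c) (h : ∀ u : ℕ → E, Orthonormal ℝ u → ¬ ∀ n, c < ‖R (u n)‖) :
    essNorm R ≤ c := by
  obtain ⟨F, hF, hFc⟩ : ∃ F : Submodule ℝ E, FiniteDimensional ℝ F ∧
      ∀ x ∈ Fᗮ, ‖x‖ = 1 → ‖R x‖ ≤ c := by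
    by_contra! hcon
    obtain ⟨_, u, _, hu, hQ⟩ := exists_orthonormal_seq_of_forall_finiteDimensional
      (fun _ x => c < ‖R x‖) (fun _ => hcon)
    exact h u hu hQ
  have hbound : ∀ x ∈ Fᗮ, ‖R x‖ ≤ c * ‖x‖ := by
    intro x hx
    rcases eq_or_ne x 0 with rfl | hx0
    · simp
    have hpos : 0 < ‖x‖ := norm_pos_iff.2 hx0
    have h1 := hFc (‖x‖⁻¹ • x) (Fᗮ.smul_mem _ hx) (by
      rw [norm_smul, norm_inv, norm_norm, inv_mul_cancel₀ hpos.ne'])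
    rwa [map_smul, norm_smul, norm_inv, norm_norm, inv_mul_le_iff₀ hpos, mul_comm] at h1
  have hcomp : IsCompactOperator (R.comp F.starProjection) := by
    have hF : IsCompactOperator (R.comp F.subtypeL) :=
      isCompactOperator_of_locallyCompactSpace_rng (R.comp F.subtypeL)
    exact hF.comp_clm F.orthogonalProjectionOnto
  refine (essNorm_le_norm_sub R _ hcomp).trans (ContinuousLinearMap.opNorm_le_bound _ hc fun x => ?_)
  have hx : (R - R.comp F.starProjection) x = R (Fᗮ.starProjection x) := by
    rw [F.starProjection_orthogonal_val]
    simp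
  rw [hx]
  exact (hbound _ (Fᗮ.starProjection_apply_mem x)).trans
    (mul_le_mul_of_nonneg_left (Fᗮ.norm_starProjection_apply_le x) hc)

/-- A `C₀`-semigroup, extended by the identity to nonpositive times. -/
structure IsC0Semigroup {E : Type*} [NormedAddCommGroup E] [NormedSpace ℝ E]
    (T : ℝ → E →L[ℝ] E) : Prop where
  of_nonpos : ∀ t ≤ 0, T t = ContinuousLinearMap.id ℝ E
  add : ∀ s, 0 ≤ s → ∀ t, 0 ≤ t → T (s + t) = (T t).comp (T s)
  bounded : ∃ C : ℝ, ∀ t ≤ 1, ‖T t‖ ≤ C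
  tendsto : ∀ f : E, Tendsto (fun t => T t f) (𝓝[>] 0) (𝓝 f)

/-- `x` is in the domain of the generator of `T`, with image `g`. -/
def HasGeneratorAt {E : Type*} [NormedAddCommGroup E] [NormedSpace ℝ E]
    (T : ℝ → E →L[ℝ] E) (x g : E) : Prop :=
  Tendsto (fun t : ℝ => t⁻¹ • (T t x - x)) (𝓝[>] (0 : ℝ)) (𝓝 g)

namespace IsC0Semigroup

variable {E : Type*} [NormedAddCommGroup E] [NormedSpace ℝ E] {T : ℝ → E →L[ℝ] E}

theorem add_apply (hT : IsC0Semigroup T) {s t : ℝ} (hs : 0 ≤ s) (ht : 0 ≤ t) (x : E) :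
    T (s + t) x = T t (T s x) := by
  rw [hT.add s hs t ht]; rfl

theorem add_apply' (hT : IsC0Semigroup T) {s t : ℝ} (hs : 0 ≤ s) (ht : 0 ≤ t) (x : E) :
    T (s + t) x = T s (T t x) := by
  rw [add_comm, hT.add_apply ht hs]

theorem exists_bound (hT : IsC0Semigroup T) (r : ℝ) : ∃ C : ℝ, ∀ t ≤ r, ‖T t‖ ≤ C := by
  obtain ⟨C, hC⟩ := hT.bounded
  obtain ⟨n, hn⟩ := exists_nat_ge r
  suffices h : ∀ n : ℕ, ∃ D : ℝ, ∀ t ≤ (n : ℝ), ‖T t‖ ≤ D by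
    obtain ⟨D, hD⟩ := h n
    exact ⟨D, fun t ht => hD t (ht.trans hn)⟩
  intro n
  induction n with
  | zero => exact ⟨C, fun t ht => hC t (ht.trans (by simp))⟩
  | succ k ih =>
    obtain ⟨D, hD⟩ := ih
    refine ⟨max C (C * D), fun t ht => ?_⟩
    rcases le_total t 1 with h1 | h1
    · exact (hC t h1).trans (le_max_left _ _)
    · refine le_trans ?_ (le_max_right _ _)
      have hsplit : T t = (T 1).comp (T (t - 1)) := by
        rw [← hT.add (t - 1) (by linarith) 1 zero_le_one, sub_add_cancel]
      rw [hsplit]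
      refine (ContinuousLinearMap.opNorm_comp_le _ _).trans ?_
      have hk : t - 1 ≤ k := by push_cast at ht; linarith
      exact mul_le_mul (hC 1 le_rfl) (hD _ hk) (norm_nonneg _)
        ((norm_nonneg _).trans (hC 1 le_rfl))

theorem tendsto_nhds_zero (hT : IsC0Semigroup T) (x : E) :
    Tendsto (fun t => T t x) (𝓝 0) (𝓝 x) := by
  rw [← nhdsLE_sup_nhdsGT]
  refine Tendsto.sup ?_ (hT.tendsto x)
  refine tendsto_const_nhds.congr' ?_
  filter_upwards [self_mem_nhdsWithin] with t ht
  rw [hT.of_nonpos t ht]; rfl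

theorem continuous (hT : IsC0Semigroup T) (x : E) : Continuous fun t => T t x := by
  obtain ⟨C, hC⟩ : ∃ C : ℝ → ℝ, ∀ r, ∀ t ≤ r, ‖T t‖ ≤ C r := by
    choose C hC using hT.exists_bound
    exact ⟨C, hC⟩
  suffices h : ContinuousOn (fun t => T t x) (Ici 0) by
    refine (h.comp_continuous (f := fun t => max t 0) (by fun_prop)
      fun t => le_max_right t 0).congr fun t => ?_
    rw [Function.comp_apply]
    rcases le_total t 0 with ht | ht
    · rw [max_eq_right ht, hT.of_nonpos t ht, hT.of_nonpos 0 le_rfl]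
    · rw [max_eq_left ht]
  intro t (ht : 0 ≤ t)
  have hz : Tendsto (fun s => C (t + 1) * ‖T |s - t| x - x‖) (𝓝 t) (𝓝 0) := by
    have h1 : Tendsto (fun s => |s - t|) (𝓝 t) (𝓝 0) := by
      have : Continuous fun s : ℝ => |s - t| := by fun_prop
      simpa using this.tendsto t
    have h2 := ((hT.tendsto_nhds_zero x).comp h1).sub_const x
    simpa using (h2.norm).const_mul (C (t + 1))
  refine tendsto_iff_norm_sub_tendsto_zero.2 (squeeze_zero'
    (.of_forall fun _ => norm_nonneg _) ?_ (hz.mono_left nhdsWithin_le_nhds))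
  have key : ∀ p q : ℝ, 0 ≤ p → p ≤ q → p ≤ t + 1 →
      ‖T q x - T p x‖ ≤ C (t + 1) * ‖T |q - p| x - x‖ := by
    intro p q hp hpq hpt
    have h1 : T q x = T p (T (q - p) x) := by
      rw [← hT.add_apply (by linarith) hp, sub_add_cancel]
    rw [h1, ← map_sub, abs_of_nonneg (by linarith)]
    exact (T p).le_of_opNorm_le (hC _ p hpt) _
  filter_upwards [self_mem_nhdsWithin,
    nhdsWithin_le_nhds (eventually_lt_nhds (show t < t + 1 by linarith))] with s hs0 hs
  rcases le_total s t with hst | hst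
  · rw [norm_sub_rev, abs_sub_comm]
    exact key s t hs0 hst hs.le
  · exact key t s ht hst (by linarith)

theorem hasGeneratorAt_apply (hT : IsC0Semigroup T) {x g : E} (h : HasGeneratorAt T x g) {t : ℝ}
    (ht : 0 ≤ t) : HasGeneratorAt T (T t x) (T t g) := by
  refine (((T t).continuous.tendsto g).comp h).congr' ?_
  filter_upwards [self_mem_nhdsWithin] with s hs
  have hs' : 0 ≤ s := le_of_lt hs
  simp only [Function.comp_apply, map_smul, map_sub]
  rw [← hT.add_apply hs' ht, ← hT.add_apply' hs' ht]

theorem hasDerivWithinAt (hT : IsC0Semigroup T) {x g : E} (h : HasGeneratorAt T x g) {t : ℝ}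
    (ht : 0 ≤ t) : HasDerivWithinAt (fun s => T s x) (T t g) (Ici t) t := by
  rw [← hasDerivWithinAt_Ioi_iff_Ici, hasDerivWithinAt_iff_tendsto_slope' (by simp)]
  have h1 : Tendsto (fun s : ℝ => s - t) (𝓝[>] t) (𝓝[>] 0) := by
    refine tendsto_nhdsWithin_iff.2 ⟨?_, ?_⟩
    · have : Continuous fun s : ℝ => s - t := by fun_prop
      exact (by simpa using this.tendsto t : Tendsto (fun s : ℝ => s - t) (𝓝 t) (𝓝 0)).mono_left
        nhdsWithin_le_nhds
    · filter_upwards [self_mem_nhdsWithin] with s hs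
      exact mem_Ioi.2 (sub_pos.2 (mem_Ioi.1 hs))
  refine ((hT.hasGeneratorAt_apply h ht).comp h1).congr' ?_
  filter_upwards [self_mem_nhdsWithin] with s hs
  have hs' : 0 ≤ s - t := sub_nonneg.2 (le_of_lt hs)
  rw [Function.comp_apply, slope_def_module, ← hT.add_apply ht hs', add_sub_cancel]

theorem exists_hasGeneratorAt_norm_sub_lt [CompleteSpace E] (hT : IsC0Semigroup T) (x : E) {ε : ℝ}
    (hε : 0 < ε) : ∃ y g, HasGeneratorAt T y g ∧ ‖y - x‖ < ε := by
  set F : ℝ → E := fun r => ∫ s in (0 : ℝ)..r, T s x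
  have hcont := hT.continuous x
  have hF : ∀ r, Tendsto (fun h : ℝ => h⁻¹ • (F (r + h) - F r)) (𝓝[>] 0) (𝓝 (T r x)) := by
    intro r
    have : HasDerivAt F (T r x) r := hcont.integral_hasStrictDerivAt 0 r |>.hasDerivAt
    exact (hasDerivAt_iff_tendsto_slope_zero.1 this).mono_left
      (nhdsWithin_mono _ fun _ h => ne_of_gt h)
  have hF0 : Tendsto (fun h : ℝ => h⁻¹ • F h) (𝓝[>] 0) (𝓝 x) := by
    simpa [F, hT.of_nonpos 0 le_rfl] using hF 0
  obtain ⟨r, hrlt, hr⟩ := (((hF0.sub_const x).norm.eventually_lt_const (u := ε) (by simpa)).and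
    self_mem_nhdsWithin).exists
  refine ⟨r⁻¹ • F r, r⁻¹ • (T r x - x), ?_, hrlt⟩
  have hlim := (((hF r).sub hF0)).const_smul r⁻¹
  refine hlim.congr' ?_
  filter_upwards [self_mem_nhdsWithin] with h hh
  have hh0 : 0 ≤ h := le_of_lt hh
  have hr0 : 0 ≤ r := le_of_lt hr
  have hTF : T h (F r) = F (r + h) - F h := by
    have e1 : T h (F r) = ∫ s in (0 : ℝ)..r, T h (T s x) :=
      ((T h).intervalIntegral_comp_comm (hcont.intervalIntegrable 0 r)).symm
    have e2 : ∫ s in (0 : ℝ)..r, T h (T s x) = ∫ s in (0 : ℝ)..r, T (s + h) x := by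
      refine intervalIntegral.integral_congr fun s hs => ?_
      rw [uIcc_of_le hr0] at hs
      exact (hT.add_apply hs.1 hh0 x).symm
    rw [e1, e2, intervalIntegral.integral_comp_add_right (fun s => T s x), zero_add]
    exact (intervalIntegral.integral_interval_sub_left (hcont.intervalIntegrable _ _)
      (hcont.intervalIntegrable _ _)).symm
  rw [map_smul, hTF]
  module

variable {H : Type*} [NormedAddCommGroup H] [InnerProductSpace ℝ H] {T : ℝ → H →L[ℝ] H}

/-- Gronwall-type energy estimate on the domain of the generator. -/
theorem exp_mul_norm_sq_le (hT : IsC0Semigroup T) {N : ℕ} (h : Fin N → H) {c ε : ℝ}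
    (hdiss : ∀ x g, HasGeneratorAt T x g → ε * ‖x‖ ^ 2 ≤ -⟪g, x⟫ + c * ∑ i, ⟪h i, x⟫ ^ 2)
    {y g : H} (hy : HasGeneratorAt T y g) {t : ℝ} (ht : 0 ≤ t) :
    Real.exp (2 * ε * t) * ‖T t y‖ ^ 2 ≤ ‖y‖ ^ 2 +
      ∫ s in (0 : ℝ)..t, Real.exp (2 * ε * s) * (2 * (c * ∑ i, ⟪h i, T s y⟫ ^ 2)) := by
  have hc := hT.continuous y
  have hint : Continuous fun s =>
      Real.exp (2 * ε * s) * (2 * (c * ∑ i, ⟪h i, T s y⟫ ^ 2)) := by fun_prop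
  have hexp : ∀ s, HasDerivAt (fun s => Real.exp (2 * ε * s))
      (Real.exp (2 * ε * s) * (2 * ε)) s := fun s =>
    ((hasDerivAt_id s).const_mul (2 * ε)).exp.congr_deriv (by simp)
  have hprim : ∀ s, HasDerivAt (fun r => ‖y‖ ^ 2 + ∫ s in (0 : ℝ)..r,
      Real.exp (2 * ε * s) * (2 * (c * ∑ i, ⟪h i, T s y⟫ ^ 2)))
      (Real.exp (2 * ε * s) * (2 * (c * ∑ i, ⟪h i, T s y⟫ ^ 2))) s := fun s =>
    (hint.integral_hasStrictDerivAt 0 s).hasDerivAt.const_add _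
  refine image_le_of_deriv_right_le_deriv_boundary
    (f := fun s => Real.exp (2 * ε * s) * ‖T s y‖ ^ 2)
    (f' := fun s => Real.exp (2 * ε * s) * (2 * ε) * ‖T s y‖ ^ 2
      + Real.exp (2 * ε * s) * (2 * ⟪T s y, T s g⟫)) (a := 0) (b := t)
    (by fun_prop) ?_ ?_ (fun s _ => (hprim s).continuousAt.continuousWithinAt)
    (fun s _ => (hprim s).hasDerivWithinAt) ?_ ⟨ht, le_rfl⟩
  · intro s hs
    exact (hexp s).hasDerivWithinAt.mul (hT.hasDerivWithinAt hy hs.1).norm_sq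
  · simp [hT.of_nonpos 0 le_rfl]
  · intro s hs
    have h1 := hdiss _ _ (hT.hasGeneratorAt_apply hy hs.1)
    rw [real_inner_comm] at h1
    rw [mul_assoc, ← mul_add]
    refine mul_le_mul_of_nonneg_left ?_ (Real.exp_nonneg _)
    linarith

theorem essNorm_le_exp [CompleteSpace H] (hT : IsC0Semigroup T) {N : ℕ} (h : Fin N → H) {c ε : ℝ}
    (hdiss : ∀ x g, HasGeneratorAt T x g → ε * ‖x‖ ^ 2 ≤ -⟪g, x⟫ + c * ∑ i, ⟪h i, x⟫ ^ 2)
    {t : ℝ} (ht : 0 ≤ t) : essNorm (T t) ≤ Real.exp (-(ε * t)) := by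
  refine le_of_forall_pos_le_add fun δ hδ => ?_
  refine essNorm_le_of_forall_orthonormal _ (by positivity) fun u hu hlt => ?_
  choose y g hy hyu using fun n : ℕ =>
    hT.exists_hasGeneratorAt_norm_sub_lt (u n) (Nat.one_div_pos_of_nat (α := ℝ) (n := n))
  have hsub : Tendsto (fun n => y n - u n) atTop (𝓝 0) :=
    squeeze_zero_norm (fun n => (hyu n).le) tendsto_one_div_add_atTop_nhds_zero_nat
  have hweak : ∀ v, Tendsto (fun n => ⟪y n, v⟫) atTop (𝓝 0) := by
    intro v
    have h1 := (hsub.inner (tendsto_const_nhds (x := v))).add (hu.tendsto_inner_zero v)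
    simpa [← inner_add_left] using h1
  have hnorm : ∀ n, ‖y n‖ ≤ 2 := by
    intro n
    have h1 : (1 : ℝ) / ((n : ℝ) + 1) ≤ 1 := by
      rw [div_le_one (by positivity)]; linarith [n.cast_nonneg (α := ℝ)]
    calc ‖y n‖ = ‖(y n - u n) + u n‖ := by rw [sub_add_cancel]
      _ ≤ ‖y n - u n‖ + ‖u n‖ := norm_add_le _ _
      _ ≤ 2 := by rw [hu.1 n]; linarith [hyu n]
  have hnorm1 : Tendsto (fun n => ‖y n‖) atTop (𝓝 1) := by
    have h1 : Tendsto (fun n => ‖y n‖ - ‖u n‖) atTop (𝓝 0) :=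
      squeeze_zero_norm (fun n => abs_norm_sub_norm_le _ _) (by simpa using hsub.norm)
    simpa [hu.1] using h1.add_const 1
  obtain ⟨C, hC⟩ := hT.exists_bound t
  have hI : Tendsto (fun n => ∫ s in (0 : ℝ)..t,
      Real.exp (2 * ε * s) * (2 * (c * ∑ i, ⟪h i, T s (y n)⟫ ^ 2))) atTop (𝓝 0) := by
    have hlim := intervalIntegral.tendsto_integral_filter_of_dominated_convergence
      (μ := MeasureTheory.volume) (a := 0) (b := t) (l := atTop)
      (F := fun n s => Real.exp (2 * ε * s) * (2 * (c * ∑ i, ⟪h i, T s (y n)⟫ ^ 2)))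
      (f := fun _ => (0 : ℝ))
      (fun s => Real.exp (2 * ε * s) * (2 * (|c| * ∑ i, (‖h i‖ * (C * 2)) ^ 2)))
      ?_ ?_ ?_ ?_
    · simpa using hlim
    · refine .of_forall fun n => Continuous.aestronglyMeasurable ?_
      have := hT.continuous (y n)
      fun_prop
    · refine .of_forall fun n => .of_forall fun s hs => ?_
      rw [uIoc_of_le ht] at hs
      rw [norm_mul, norm_mul, norm_mul, Real.norm_of_nonneg (Real.exp_nonneg _),
        Real.norm_ofNat, Real.norm_eq_abs c,
        Real.norm_of_nonneg (Finset.sum_nonneg fun i _ => sq_nonneg _)]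
      have hs2 : ∑ i, ⟪h i, T s (y n)⟫ ^ 2 ≤ ∑ i, (‖h i‖ * (C * 2)) ^ 2 := by
        refine Finset.sum_le_sum fun i _ => sq_le_sq.2 (le_trans ?_ (le_abs_self _))
        refine (abs_real_inner_le_norm _ _).trans ?_
        gcongr
        exact (T s).le_of_opNorm_le_of_le (hC s hs.2) (hnorm n)
      gcongr
    · exact Continuous.intervalIntegrable (by fun_prop) _ _
    · refine .of_forall fun s _ => ?_
      have h1 : ∀ i, Tendsto (fun n => ⟪h i, T s (y n)⟫) atTop (𝓝 0) := by
        intro i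
        refine (hweak (ContinuousLinearMap.adjoint (T s) (h i))).congr fun n => ?_
        rw [ContinuousLinearMap.adjoint_inner_right, real_inner_comm]
      have h2 := tendsto_finsetSum Finset.univ fun i _ => (h1 i).pow 2
      simpa using ((h2.const_mul c).const_mul 2).const_mul (Real.exp (2 * ε * s))
  have hR := (hnorm1.pow 2).add hI
  have hTsub : Tendsto (fun n => ‖T t (y n - u n)‖) atTop (𝓝 0) := by
    simpa using (((T t).continuous.tendsto 0).comp hsub).norm
  have hL : Tendsto (fun n => Real.exp (2 * ε * t) *
      (Real.exp (-(ε * t)) + δ - ‖T t (y n - u n)‖) ^ 2) atTop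
      (𝓝 (Real.exp (2 * ε * t) * (Real.exp (-(ε * t)) + δ) ^ 2)) := by
    simpa using ((hTsub.const_sub (Real.exp (-(ε * t)) + δ)).pow 2).const_mul (Real.exp (2 * ε * t))
  have hle := le_of_tendsto_of_tendsto hL hR (by
    filter_upwards [hTsub.eventually_lt_const hδ] with n hn
    refine le_trans ?_ (hT.exp_mul_norm_sq_le h hdiss (hy n) ht)
    have h1 : ‖T t (u n)‖ ≤ ‖T t (y n)‖ + ‖T t (y n - u n)‖ := by
      rw [map_sub, norm_sub_rev]
      simpa using norm_add_le (T t (y n)) (T t (u n) - T t (y n))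
    have h2 := hlt n
    have h3 := Real.exp_nonneg (-(ε * t))
    gcongr
    · linarith
    · linarith)
  have hsq : Real.exp (2 * ε * t) * Real.exp (-(ε * t)) ^ 2 = 1 := by
    rw [← Real.exp_nat_mul, ← Real.exp_add, ← Real.exp_zero]
    congr 1
    push_cast
    ring
  have hgt : Real.exp (2 * ε * t) * Real.exp (-(ε * t)) ^ 2
      < Real.exp (2 * ε * t) * (Real.exp (-(ε * t)) + δ) ^ 2 := by
    gcongr
    linarith
  linarith

end IsC0Semigroup

/-- Extending an operator family on `(0, ∞)` by the identity yields a `C₀`-semigroup. -/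
theorem isC0Semigroup_extend {E : Type*} [NormedAddCommGroup E] [NormedSpace ℝ E]
    (S : ℝ → E →L[ℝ] E)
    (hsg : ∀ s ∈ Ioi (0 : ℝ), ∀ t ∈ Ioi (0 : ℝ), S (s + t) = (S t).comp (S s))
    (hloc : ∃ C : ℝ, ∀ t ∈ Ioc (0 : ℝ) 1, ‖S t‖ ≤ C)
    (hc0 : ∀ f : E, Tendsto (fun t : ℝ => S t f) (𝓝[>] (0 : ℝ)) (𝓝 f)) :
    IsC0Semigroup fun t => if 0 < t then S t else ContinuousLinearMap.id ℝ E where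
  of_nonpos t ht := if_neg ht.not_gt
  add s hs t ht := by
    rcases hs.eq_or_lt with rfl | hs
    · simp
    rcases ht.eq_or_lt with rfl | ht
    · simp
    simp only [hs, ht, add_pos hs ht, if_true]
    exact hsg s hs t ht
  bounded := by
    obtain ⟨C, hC⟩ := hloc
    refine ⟨max C 1, fun t ht => ?_⟩
    split_ifs with h
    · exact (hC t ⟨h, ht⟩).trans (le_max_left _ _)
    · exact ContinuousLinearMap.norm_id_le.trans (le_max_right _ _)
  tendsto f := by
    refine (hc0 f).congr' ?_
    filter_upwards [self_mem_nhdsWithin] with t ht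
    rw [if_pos (mem_Ioi.1 ht)]

/-- Let `V` be a Hilbert space densely and continuously embedded into a
real Hilbert space `H` (via `ι`) and let `a : V × V → ℝ` be bilinear, continuous and
essentially positive-coercive (if `u_n ⇀ 0` weakly in `V` and `limsup a(u_n, u_n) ≤ 0`,
then `‖u_n‖_V → 0`).  Then `(a, V)` is a closed form (`a` is elliptic) and the associated
`C₀`-semigroup `S` on `H` is asymptotically compact, i.e. `‖S t‖_ess → 0` as `t → ∞`. -/
theorem statement12
    {H : Type*} [NormedAddCommGroup H] [InnerProductSpace ℝ H] [CompleteSpace H]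
    {V : Type*} [NormedAddCommGroup V] [InnerProductSpace ℝ V] [CompleteSpace V]
    (ι : V →L[ℝ] H) (hinj : Function.Injective ⇑ι) (hdense : DenseRange ⇑ι)
    (a : V →ₗ[ℝ] V →ₗ[ℝ] ℝ)
    (hcont : ∃ M : ℝ, ∀ u v : V, |a u v| ≤ M * ‖u‖ * ‖v‖)
    -- essential positive-coercivity:
    (hepc : ∀ u : ℕ → V,
      (∀ v : V, Tendsto (fun n : ℕ => ⟪u n, v⟫) atTop (𝓝 0)) →
      (∀ ε : ℝ, 0 < ε → ∀ᶠ n : ℕ in atTop, a (u n) (u n) ≤ ε) →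
      Tendsto (fun n : ℕ => ‖u n‖) atTop (𝓝 0))
    -- `S` is the `C₀`-semigroup associated with the form `(a, V)`:
    (S : ℝ → H →L[ℝ] H)
    (hsg : ∀ s ∈ Ioi (0 : ℝ), ∀ t ∈ Ioi (0 : ℝ), S (s + t) = (S t).comp (S s))
    (hloc : ∃ C : ℝ, ∀ t ∈ Ioc (0 : ℝ) 1, ‖S t‖ ≤ C)
    (hc0 : ∀ f : H, Tendsto (fun t : ℝ => S t f) (𝓝[>] (0 : ℝ)) (𝓝 f))
    (hgen : ∀ x g : H,
      Tendsto (fun t : ℝ => t⁻¹ • (S t x - x)) (𝓝[>] (0 : ℝ)) (𝓝 g) ↔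
        ∃ u : V, ι u = x ∧ ∀ v : V, a u v = -⟪g, ι v⟫) :
    -- the form is closed (elliptic) and the semigroup is asymptotically compact:
    (∃ ω : ℝ, 0 ≤ ω ∧ ∃ α : ℝ, 0 < α ∧
      ∀ u : V, α * ‖u‖ ^ 2 ≤ a u u + ω * ‖ι u‖ ^ 2) ∧
    Tendsto (fun t : ℝ => essNorm (S t)) atTop (𝓝 0) := by
  obtain ⟨N, h, c, α, hc, hα, hco⟩ := exists_finite_rank_coercive ι hinj a hcont hepc
  refine ⟨⟨c * ∑ i, ‖h i‖ ^ 2, by positivity, α, hα, fun u => (hco u).trans ?_⟩, ?_⟩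
  · rw [mul_assoc, Finset.sum_mul]
    have hs : ∑ i, ⟪h i, ι u⟫ ^ 2 ≤ ∑ i, ‖h i‖ ^ 2 * ‖ι u‖ ^ 2 := by
      refine Finset.sum_le_sum fun i _ => ?_
      rw [← mul_pow]
      exact sq_le_sq.2 ((abs_real_inner_le_norm _ _).trans (le_abs_self _))
    gcongr
  set T : ℝ → H →L[ℝ] H := fun t => if 0 < t then S t else ContinuousLinearMap.id ℝ H
  have hT : IsC0Semigroup T := isC0Semigroup_extend S hsg hloc hc0
  have hTS : ∀ t, 0 < t → T t = S t := fun t ht => if_pos ht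
  set ε : ℝ := α / (‖ι‖ ^ 2 + 1) with hε
  have hε0 : 0 < ε := by positivity
  have hdiss : ∀ x g, HasGeneratorAt T x g →
      ε * ‖x‖ ^ 2 ≤ -⟪g, x⟫ + c * ∑ i, ⟪h i, x⟫ ^ 2 := by
    intro x g hx
    obtain ⟨u, rfl, hu⟩ := (hgen x g).1 (hx.congr' (by
      filter_upwards [self_mem_nhdsWithin] with t ht
      rw [hTS t ht]))
    rw [← hu u]
    refine le_trans ?_ (hco u)
    have h1 : ‖ι u‖ ^ 2 ≤ (‖ι‖ ^ 2 + 1) * ‖u‖ ^ 2 := by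
      have := pow_le_pow_left₀ (norm_nonneg _) (ι.le_opNorm u) 2
      nlinarith [sq_nonneg ‖u‖]
    rw [hε, div_mul_eq_mul_div, div_le_iff₀ (by positivity)]
    nlinarith
  refine tendsto_of_tendsto_of_tendsto_of_le_of_le' tendsto_const_nhds
    (h := fun t => Real.exp (-(ε * t))) ?_ (.of_forall fun t => essNorm_nonneg _) ?_
  · exact Real.tendsto_exp_neg_atTop_nhds_zero.comp (tendsto_id.const_mul_atTop hε0)
  · filter_upwards [eventually_gt_atTop 0] with t ht
    rw [← hTS t ht]
    exact hT.essNorm_le_exp h hdiss ht.le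
end

section
/- Let (Ω, μ) be a σ-finite measure space, H = L²(Ω, μ), let (a, V) be a closed form on H and let S be the associated C₀-semigroup on H. Assume that S is positive. If for each measurable set B ⊆ Ω the condition 𝟙_B V ⊆ V (i.e. 𝟙_B u ∈ V for every u ∈ V) implies μ(B) = 0 or μ(Ω \ B) = 0, then S is irreducible. -/
open Filter Topology Set MeasureTheory
open scoped RealInnerProductSpace ENNReal

namespace ClosedForm

section Semigroup

variable {H : Type*} [NormedAddCommGroup H] [NormedSpace ℝ H] {S : ℝ → H →L[ℝ] H}

lemma tendsto_sub_nhdsGT (t : ℝ) : Tendsto (fun s : ℝ => s - t) (𝓝[>] t) (𝓝[>] 0) := by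
  refine tendsto_nhdsWithin_iff.2 ⟨?_, ?_⟩
  · have : Tendsto (fun s : ℝ => s - t) (𝓝 t) (𝓝 (t - t)) :=
      (by fun_prop : Continuous fun s : ℝ => s - t).tendsto t
    rw [sub_self] at this
    exact this.mono_left nhdsWithin_le_nhds
  · filter_upwards [self_mem_nhdsWithin] with s hs
    exact sub_pos.2 (mem_Ioi.1 hs)

lemma apply_eq_apply_sub
    (hsg : ∀ s ∈ Ioi (0 : ℝ), ∀ t ∈ Ioi (0 : ℝ), S (s + t) = (S t).comp (S s))
    {s t : ℝ} (hs : 0 < s) (hst : s < t) (x : H) : S t x = S s (S (t - s) x) := by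
  have h := hsg (t - s) (sub_pos.2 hst) s hs
  rw [sub_add_cancel] at h
  rw [h, ContinuousLinearMap.comp_apply]

lemma tendsto_orbit_nhdsGT
    (hsg : ∀ s ∈ Ioi (0 : ℝ), ∀ t ∈ Ioi (0 : ℝ), S (s + t) = (S t).comp (S s))
    (hc0 : ∀ f : H, Tendsto (fun t : ℝ => S t f) (𝓝[>] (0 : ℝ)) (𝓝 f))
    {t : ℝ} (ht : 0 < t) (x : H) : Tendsto (fun s => S s x) (𝓝[>] t) (𝓝 (S t x)) := by
  refine (((S t).continuous.tendsto x).comp ((hc0 x).comp (tendsto_sub_nhdsGT t))).congr' ?_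
  filter_upwards [self_mem_nhdsWithin] with s hs
  exact (apply_eq_apply_sub hsg ht hs x).symm

lemma hasDerivWithinAt_orbit
    (hsg : ∀ s ∈ Ioi (0 : ℝ), ∀ t ∈ Ioi (0 : ℝ), S (s + t) = (S t).comp (S s))
    {x g : H} (hx : Tendsto (fun t : ℝ => t⁻¹ • (S t x - x)) (𝓝[>] (0 : ℝ)) (𝓝 g))
    {t : ℝ} (ht : 0 < t) : HasDerivWithinAt (fun s => S s x) (S t g) (Ici t) t := by
  rw [← hasDerivWithinAt_Ioi_iff_Ici, hasDerivWithinAt_iff_tendsto_slope' self_notMem_Ioi]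
  refine (((S t).continuous.tendsto g).comp (hx.comp (tendsto_sub_nhdsGT t))).congr' ?_
  filter_upwards [self_mem_nhdsWithin] with s hs
  simp [slope_def_module, apply_eq_apply_sub hsg ht hs x]

lemma continuousOn_orbit
    (hsg : ∀ s ∈ Ioi (0 : ℝ), ∀ t ∈ Ioi (0 : ℝ), S (s + t) = (S t).comp (S s))
    (hloc : ∃ C : ℝ, ∀ t ∈ Ioc (0 : ℝ) 1, ‖S t‖ ≤ C)
    (hc0 : ∀ f : H, Tendsto (fun t : ℝ => S t f) (𝓝[>] (0 : ℝ)) (𝓝 f)) (x : H) :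
    ContinuousOn (fun s => S s x) (Ioc 0 1) := by
  obtain ⟨C, hC⟩ := hloc
  intro t ht
  rw [← continuousWithinAt_sdiff_self]
  have key : ∀ s t : ℝ, s ∈ Ioc (0 : ℝ) 1 → s < t →
      ‖S t x - S s x‖ ≤ C * ‖S (t - s) x - x‖ := by
    intro s t hs hst
    rw [apply_eq_apply_sub hsg hs.1 hst x, ← map_sub]
    exact (S s).le_of_opNorm_le (hC s hs) _
  have habs : Tendsto (fun s : ℝ => |s - t|) (𝓝[Ioc 0 1 \ {t}] t) (𝓝[>] 0) := by
    refine tendsto_nhdsWithin_iff.2 ⟨?_, ?_⟩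
    · have : Tendsto (fun s : ℝ => |s - t|) (𝓝 t) (𝓝 |t - t|) :=
        (by fun_prop : Continuous fun s : ℝ => |s - t|).tendsto t
      rw [sub_self, abs_zero] at this
      exact this.mono_left nhdsWithin_le_nhds
    · filter_upwards [self_mem_nhdsWithin] with s hs
      exact abs_pos.2 (sub_ne_zero.2 hs.2)
  have hlim : Tendsto (fun s : ℝ => C * ‖S |s - t| x - x‖) (𝓝[Ioc 0 1 \ {t}] t) (𝓝 0) := by
    simpa using ((((hc0 x).comp habs).sub_const x).norm).const_mul C
  refine tendsto_iff_norm_sub_tendsto_zero.2 (squeeze_zero' (.of_forall fun _ => norm_nonneg _)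
    ?_ hlim)
  filter_upwards [self_mem_nhdsWithin] with s hs
  rcases lt_or_gt_of_ne hs.2 with h | h
  · rw [norm_sub_rev, abs_sub_comm, abs_of_pos (sub_pos.2 h)]
    exact key s t hs.1 h
  · rw [abs_of_pos (sub_pos.2 h)]
    exact key t s ht h

end Semigroup

section Invariance

variable {H : Type*} [NormedAddCommGroup H] [InnerProductSpace ℝ H] {S : ℝ → H →L[ℝ] H}

lemma mem_orthogonal_span {N : Set H} {h : H} :
    h ∈ (Submodule.span ℝ N)ᗮ ↔ ∀ φ ∈ N, ⟪φ, h⟫ = 0 := by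
  refine ⟨fun hh φ hφ => hh φ (Submodule.subset_span hφ), fun hh => ?_⟩
  have hle : Submodule.span ℝ N ≤ (ℝ ∙ h)ᗮ := Submodule.span_le.2 fun φ hφ => by
    rw [SetLike.mem_coe, Submodule.mem_orthogonal_singleton_iff_inner_left]
    exact hh φ hφ
  intro φ hφ
  exact Submodule.mem_orthogonal_singleton_iff_inner_left.1 (hle hφ)

/-- The resolvent, at a point `l` with `‖S 1‖ < exp l`, of a `C₀`-semigroup leaves every invariant
complemented subspace invariant. -/
lemma mem_of_resolvent
    (hsg : ∀ s ∈ Ioi (0 : ℝ), ∀ t ∈ Ioi (0 : ℝ), S (s + t) = (S t).comp (S s))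
    (hloc : ∃ C : ℝ, ∀ t ∈ Ioc (0 : ℝ) 1, ‖S t‖ ≤ C)
    (hc0 : ∀ f : H, Tendsto (fun t : ℝ => S t f) (𝓝[>] (0 : ℝ)) (𝓝 f))
    (K : Submodule ℝ H) [K.HasOrthogonalProjection]
    (hK : ∀ t ∈ Ioi (0 : ℝ), ∀ h ∈ K, S t h ∈ K) {l : ℝ} (hl : ‖S 1‖ < Real.exp l)
    {x h : H} (hh : h ∈ K)
    (hx : Tendsto (fun t : ℝ => t⁻¹ • (S t x - x)) (𝓝[>] (0 : ℝ)) (𝓝 (l • x - h))) :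
    x ∈ K := by
  set Q : H →L[ℝ] H := Kᗮ.starProjection with hQ
  have hQK : ∀ k ∈ K, Q k = 0 := fun k hk => by
    rw [hQ, Submodule.starProjection_apply_eq_zero_iff]
    exact K.le_orthogonal_orthogonal hk
  set F : ℝ → H := fun t => Real.exp (-l * t) • Q (S t x) with hF
  have hder : ∀ t : ℝ, 0 < t → HasDerivWithinAt F 0 (Ici t) t := by
    intro t ht
    have h1 : HasDerivAt (fun t : ℝ => Real.exp (-l * t)) (Real.exp (-l * t) * (-l)) t := by
      simpa using ((hasDerivAt_id t).const_mul (-l)).exp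
    have h2 : HasDerivWithinAt (fun s => Q (S s x)) (Q (S t (l • x - h))) (Ici t) t :=
      Q.hasFDerivAt.comp_hasDerivWithinAt t (hasDerivWithinAt_orbit hsg hx ht)
    convert HasDerivWithinAt.fun_smul h1.hasDerivWithinAt h2 using 1
    rw [map_sub, map_sub, hQK _ (hK t ht h hh), map_smul, map_smul]
    module
  have hcont : ContinuousOn F (Ioc 0 1) :=
    (by fun_prop : Continuous fun t : ℝ => Real.exp (-l * t)).continuousOn.smul
      (Q.continuous.comp_continuousOn (continuousOn_orbit hsg hloc hc0 x))
  have hconst : ∀ t ∈ Ioc (0 : ℝ) 1, F 1 = F t := fun t ht =>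
    constant_of_has_deriv_right_zero (hcont.mono fun s hs => ⟨ht.1.trans_le hs.1, hs.2⟩)
      (fun s hs => hder s (ht.1.trans_le hs.1)) 1 ⟨ht.2, le_rfl⟩
  have hlim : Tendsto F (𝓝[>] 0) (𝓝 (Q x)) := by
    have h1 : Tendsto (fun t : ℝ => Real.exp (-l * t)) (𝓝[>] 0) (𝓝 1) := by
      have : Tendsto (fun t : ℝ => Real.exp (-l * t)) (𝓝 0) (𝓝 (Real.exp (-l * 0))) :=
        (by fun_prop : Continuous fun t : ℝ => Real.exp (-l * t)).tendsto 0
      simpa using this.mono_left nhdsWithin_le_nhds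
    have h2 := h1.smul ((Q.continuous.tendsto x).comp (hc0 x))
    rwa [one_smul] at h2
  have hF1 : F 1 = Q x := by
    refine tendsto_nhds_unique (tendsto_const_nhds.congr' ?_) hlim
    filter_upwards [Ioc_mem_nhdsGT one_pos] with t ht using hconst t ht
  have hQS : Q (S 1 x) = Q (S 1 (Q x)) := by
    have : x - Q x ∈ K := by
      have h3 := K.starProjection_add_starProjection_orthogonal x
      rw [← hQ] at h3
      rw [sub_eq_of_eq_add h3.symm]
      exact K.starProjection_apply_mem x
    rw [← sub_eq_zero, ← map_sub, ← map_sub]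
    exact hQK _ (hK 1 (mem_Ioi.2 one_pos) _ this)
  have hnorm : Real.exp l * ‖Q x‖ ≤ ‖S 1‖ * ‖Q x‖ := by
    have h4 : Real.exp l • Q x = Q (S 1 (Q x)) := by
      rw [← hQS, ← hF1, hF, smul_smul, ← Real.exp_add]
      simp
    calc Real.exp l * ‖Q x‖ = ‖Real.exp l • Q x‖ := by
          rw [norm_smul, Real.norm_of_nonneg (Real.exp_pos l).le]
      _ = ‖Q (S 1 (Q x))‖ := by rw [h4]
      _ ≤ ‖S 1 (Q x)‖ := Submodule.norm_starProjection_apply_le _ _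
      _ ≤ ‖S 1‖ * ‖Q x‖ := (S 1).le_opNorm _
  have hQx : Q x = 0 := by
    by_contra h0
    exact absurd (le_of_mul_le_mul_right hnorm (norm_pos_iff.2 h0)) (not_le.2 hl)
  rw [hQ, Submodule.starProjection_apply_eq_zero_iff, Submodule.orthogonal_orthogonal] at hQx
  exact hQx

end Invariance

section Form

variable {H : Type*} [NormedAddCommGroup H] [InnerProductSpace ℝ H] [CompleteSpace H]
  {V : Type*} [NormedAddCommGroup V] [InnerProductSpace ℝ V] [CompleteSpace V]

/-- Lax–Milgram for the shifted form `a + l ⟪ι ·, ι ·⟫`. -/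
lemma exists_resolvent (ι : V →L[ℝ] H) (a : V →ₗ[ℝ] V →ₗ[ℝ] ℝ)
    (hcont : ∃ M : ℝ, ∀ u v : V, |a u v| ≤ M * ‖u‖ * ‖v‖) {ω α l : ℝ} (hα : 0 < α)
    (hell : ∀ u : V, α * ‖u‖ ^ 2 ≤ a u u + ω * ‖ι u‖ ^ 2) (hl : ω ≤ l) (h : H) :
    ∃ x : V, ∀ v, a x v = -⟪l • ι x - h, ι v⟫ := by
  obtain ⟨M, hM⟩ := hcont
  have hbound : ∀ u v : V,
      ‖(a + l • (innerₗ H).compl₁₂ ι.toLinearMap ι.toLinearMap) u v‖ ≤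
        (M + |l| * (‖ι‖ * ‖ι‖)) * ‖u‖ * ‖v‖ := by
    intro u v
    have h1 : |⟪ι u, ι v⟫| ≤ (‖ι‖ * ‖u‖) * (‖ι‖ * ‖v‖) :=
      (abs_real_inner_le_norm _ _).trans
        (mul_le_mul (ι.le_opNorm u) (ι.le_opNorm v) (norm_nonneg _) (by positivity))
    calc ‖(a + l • (innerₗ H).compl₁₂ ι.toLinearMap ι.toLinearMap) u v‖
        = |a u v + l * ⟪ι u, ι v⟫| := by simp
      _ ≤ |a u v| + |l| * |⟪ι u, ι v⟫| := (abs_add_le _ _).trans_eq (by rw [abs_mul])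
      _ ≤ M * ‖u‖ * ‖v‖ + |l| * ((‖ι‖ * ‖u‖) * (‖ι‖ * ‖v‖)) :=
          add_le_add (hM u v) (mul_le_mul_of_nonneg_left h1 (abs_nonneg l))
      _ = _ := by ring
  set B : V →L[ℝ] V →L[ℝ] ℝ := LinearMap.mkContinuous₂ _ _ hbound with hB
  have hBapp : ∀ u v, B u v = a u v + l * ⟪ι u, ι v⟫ := by
    intro u v
    simp [hB]
  have hcoer : IsCoercive B := by
    refine ⟨α, hα, fun u => ?_⟩
    rw [hBapp, real_inner_self_eq_norm_sq]
    nlinarith [hell u, mul_le_mul_of_nonneg_right hl (sq_nonneg ‖ι u‖)]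
  refine ⟨hcoer.continuousLinearEquivOfBilin.symm (ContinuousLinearMap.adjoint ι h), fun v => ?_⟩
  have := hcoer.continuousLinearEquivOfBilin_apply
    (hcoer.continuousLinearEquivOfBilin.symm (ContinuousLinearMap.adjoint ι h)) v
  rw [ContinuousLinearEquiv.apply_symm_apply, hBapp, ContinuousLinearMap.adjoint_inner_left] at this
  rw [inner_sub_left, real_inner_smul_left]
  linarith

/-- The image of a bounded sequence under a bounded operator out of a Hilbert space can only
converge to a point of the range. -/
lemma mem_range_of_tendsto_of_bounded (ι : V →L[ℝ] H) {x : ℕ → V} {R : ℝ} (hR : ∀ n, ‖x n‖ ≤ R)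
    {y : H} (hy : Tendsto (fun n => ι (x n)) atTop (𝓝 y)) : ∃ z, ι z = y := by
  set D : V → WeakDual ℝ V := fun v => StrongDual.toWeakDual (InnerProductSpace.toDual ℝ V v)
    with hD
  have hcomp := WeakDual.isCompact_closedBall (𝕜 := ℝ) (0 : StrongDual ℝ V) R
  obtain ⟨φ, -, hφ⟩ := hcomp.ultrafilter_le_nhds
    ((hyperfilter ℕ).map fun n => D (x n)) (by
      rw [le_principal_iff, Ultrafilter.mem_coe, Ultrafilter.mem_map]
      refine univ_mem' fun n => ?_
      simpa [hD] using hR n)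
  refine ⟨(InnerProductSpace.toDual ℝ V).symm (WeakDual.toStrongDual φ), ?_⟩
  refine ext_inner_right ℝ fun h => ?_
  have h1 : Tendsto (fun n => D (x n) (ContinuousLinearMap.adjoint ι h)) (hyperfilter ℕ)
      (𝓝 (φ (ContinuousLinearMap.adjoint ι h))) :=
    ((WeakDual.eval_continuous (ContinuousLinearMap.adjoint ι h)).tendsto φ).comp hφ
  have h2 : Tendsto (fun n => ⟪ι (x n), h⟫) (hyperfilter ℕ) (𝓝 ⟪y, h⟫) :=
    (hy.inner tendsto_const_nhds).mono_left Nat.hyperfilter_le_atTop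
  have h3 : ∀ n, D (x n) (ContinuousLinearMap.adjoint ι h) = ⟪ι (x n), h⟫ := fun n => by
    simp [hD, ContinuousLinearMap.adjoint_inner_right]
  simp only [h3] at h1
  rw [tendsto_nhds_unique h2 h1, ← ContinuousLinearMap.adjoint_inner_right,
    InnerProductSpace.toDual_symm_apply]
  rfl

/-- If a closed subspace is invariant under the semigroup associated with a closed form, then the
orthogonal projection onto it preserves the form domain. -/
lemma exists_eq_starProjection_of_invariant
    (ι : V →L[ℝ] H) (a : V →ₗ[ℝ] V →ₗ[ℝ] ℝ)
    (hcont : ∃ M : ℝ, ∀ u v : V, |a u v| ≤ M * ‖u‖ * ‖v‖)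
    (hell : ∃ ω : ℝ, 0 ≤ ω ∧ ∃ α : ℝ, 0 < α ∧
      ∀ u : V, α * ‖u‖ ^ 2 ≤ a u u + ω * ‖ι u‖ ^ 2)
    {S : ℝ → H →L[ℝ] H}
    (hsg : ∀ s ∈ Ioi (0 : ℝ), ∀ t ∈ Ioi (0 : ℝ), S (s + t) = (S t).comp (S s))
    (hloc : ∃ C : ℝ, ∀ t ∈ Ioc (0 : ℝ) 1, ‖S t‖ ≤ C)
    (hc0 : ∀ f : H, Tendsto (fun t : ℝ => S t f) (𝓝[>] (0 : ℝ)) (𝓝 f))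
    (hgen : ∀ x g : H,
      Tendsto (fun t : ℝ => t⁻¹ • (S t x - x)) (𝓝[>] (0 : ℝ)) (𝓝 g) ↔
        ∃ u : V, ι u = x ∧ ∀ v : V, a u v = -⟪g, ι v⟫)
    (K : Submodule ℝ H) [K.HasOrthogonalProjection]
    (hK : ∀ t ∈ Ioi (0 : ℝ), ∀ h ∈ K, S t h ∈ K) (u : V) :
    ∃ w : V, ι w = K.starProjection (ι u) := by
  obtain ⟨ω, hω, α, hα, hell⟩ := hell
  set y := K.starProjection (ι u) with hy
  have hyK : y ∈ K := K.starProjection_apply_mem _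
  set l₀ : ℝ := 2 * ω + Real.log (‖S 1‖ + 1) with hl₀
  have hlog : 0 ≤ Real.log (‖S 1‖ + 1) := Real.log_nonneg (by linarith [norm_nonneg (S 1)])
  have hres : ∀ n : ℕ, ∃ x : V, ι x ∈ K ∧ ∀ v, a x v = -((l₀ + n) * ⟪ι x - y, ι v⟫) := by
    intro n
    have hn : (0 : ℝ) ≤ n := n.cast_nonneg
    obtain ⟨x, hx⟩ := exists_resolvent ι a hcont hα hell (l := l₀ + n) (by linarith)
      ((l₀ + n) • y)
    refine ⟨x, ?_, fun v => ?_⟩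
    · refine mem_of_resolvent hsg hloc hc0 K hK (l := l₀ + n) ?_ (K.smul_mem (l₀ + n) hyK)
        ((hgen _ _).2 ⟨x, rfl, hx⟩)
      calc ‖S 1‖ < ‖S 1‖ + 1 := by linarith
        _ = Real.exp (Real.log (‖S 1‖ + 1)) := (Real.exp_log (by positivity)).symm
        _ ≤ Real.exp (l₀ + n) := Real.exp_le_exp.2 (by linarith)
    · rw [hx, ← smul_sub, real_inner_smul_left]
  choose x hxK hx using hres
  obtain ⟨M, hM⟩ := hcont
  set R : ℝ := M ^ 2 * ‖u‖ ^ 2 / (2 * α) + 2 * ω * ‖y‖ ^ 2 with hRdef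
  have hest : ∀ n : ℕ, α / 2 * ‖x n‖ ^ 2 + n * ‖ι (x n) - y‖ ^ 2 ≤ R := by
    intro n
    have horth : ⟪ι (x n) - y, ι u - y⟫ = 0 := by
      rw [hy]
      exact K.sub_starProjection_mem_orthogonal (ι u) _ (K.sub_mem (hxK n) hyK)
    have h1 : a (x n) (x n) = a (x n) u - (l₀ + n) * ‖ι (x n) - y‖ ^ 2 := by
      rw [hx n (x n), hx n u, ← real_inner_self_eq_norm_sq]
      have e1 : ⟪ι (x n) - y, ι (x n)⟫ = ⟪ι (x n) - y, ι (x n) - y⟫ + ⟪ι (x n) - y, y⟫ := by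
        rw [← inner_add_right, sub_add_cancel]
      have e2 : ⟪ι (x n) - y, ι u⟫ = ⟪ι (x n) - y, y⟫ := by
        rw [inner_sub_right] at horth
        linarith
      rw [e1, e2]
      ring
    have h2 : ‖ι (x n)‖ ^ 2 ≤ 2 * ‖ι (x n) - y‖ ^ 2 + 2 * ‖y‖ ^ 2 := by
      have : ‖ι (x n)‖ ≤ ‖ι (x n) - y‖ + ‖y‖ := by
        simpa using norm_add_le (ι (x n) - y) y
      nlinarith [norm_nonneg (ι (x n)), sq_nonneg (‖ι (x n) - y‖ - ‖y‖)]
    have h3 : a (x n) u ≤ α / 2 * ‖x n‖ ^ 2 + M ^ 2 * ‖u‖ ^ 2 / (2 * α) := by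
      refine (le_abs_self _).trans ((hM _ _).trans ?_)
      have : 0 ≤ (α * ‖x n‖ - M * ‖u‖) ^ 2 / (2 * α) := by positivity
      have e : (α * ‖x n‖ - M * ‖u‖) ^ 2 / (2 * α) = α / 2 * ‖x n‖ ^ 2 +
          M ^ 2 * ‖u‖ ^ 2 / (2 * α) - M * ‖x n‖ * ‖u‖ := by
        field_simp
        ring
      linarith
    have h4 := hell (x n)
    have h5 := mul_le_mul_of_nonneg_left h2 hω
    have h6 : 0 ≤ Real.log (‖S 1‖ + 1) * ‖ι (x n) - y‖ ^ 2 := by positivity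
    rw [h1, hl₀] at h4
    rw [hRdef]
    linarith
  refine mem_range_of_tendsto_of_bounded ι (x := x) (R := √(R / (α / 2))) (fun n => ?_) ?_
  · refine Real.le_sqrt_of_sq_le ((le_div_iff₀' (by positivity)).2 ?_)
    have : 0 ≤ (n : ℝ) * ‖ι (x n) - y‖ ^ 2 := by positivity
    linarith [hest n]
  · rw [tendsto_iff_norm_sub_tendsto_zero]
    have hlim : Tendsto (fun n : ℕ => √(R / n)) atTop (𝓝 0) := by
      have := (Real.continuous_sqrt.tendsto 0).comp (tendsto_const_div_atTop_nhds_zero_nat R)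
      rwa [Real.sqrt_zero] at this
    refine squeeze_zero' (.of_forall fun _ => norm_nonneg _) ?_ hlim
    filter_upwards [eventually_gt_atTop 0] with n hn
    have hn' : (0 : ℝ) < n := Nat.cast_pos.2 hn
    refine Real.le_sqrt_of_sq_le ((le_div_iff₀' hn').2 ?_)
    have : 0 ≤ α / 2 * ‖x n‖ ^ 2 := by positivity
    linarith [hest n]

end Form

section L2

variable {Ω : Type*} [MeasurableSpace Ω] {μ : Measure Ω}

lemma inner_eq_integral_mul (φ ψ : Lp ℝ 2 μ) : ⟪φ, ψ⟫ = ∫ x, φ x * ψ x ∂μ := by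
  rw [L2.inner_def]
  exact integral_congr_ae (.of_forall fun x => by simp [mul_comm])

lemma integrable_mul (φ ψ : Lp ℝ 2 μ) : Integrable (fun x => φ x * ψ x) μ :=
  (L2.integrable_inner (𝕜 := ℝ) φ ψ).congr (.of_forall fun x => by simp [mul_comm])

lemma inner_nonneg_of_nonneg {φ ψ : Lp ℝ 2 μ} (hφ : 0 ≤ φ) (hψ : 0 ≤ ψ) : 0 ≤ ⟪φ, ψ⟫ := by
  rw [inner_eq_integral_mul]
  refine integral_nonneg_of_ae ?_
  filter_upwards [(Lp.coeFn_nonneg φ).2 hφ, (Lp.coeFn_nonneg ψ).2 hψ] with x h1 h2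
  exact mul_nonneg h1 h2

lemma mul_ae_eq_zero_of_inner_eq_zero {φ ψ : Lp ℝ 2 μ} (hφ : 0 ≤ φ) (hψ : 0 ≤ ψ)
    (h : ⟪φ, ψ⟫ = 0) : ∀ᵐ x ∂μ, φ x * ψ x = 0 := by
  rw [inner_eq_integral_mul] at h
  refine (integral_eq_zero_iff_of_nonneg_ae ?_ (integrable_mul φ ψ)).1 h
  filter_upwards [(Lp.coeFn_nonneg φ).2 hφ, (Lp.coeFn_nonneg ψ).2 hψ] with x h1 h2
  exact mul_nonneg h1 h2

lemma inner_eq_zero_of_mul_ae_eq_zero {φ ψ : Lp ℝ 2 μ} (h : ∀ᵐ x ∂μ, φ x * ψ x = 0) :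
    ⟪φ, ψ⟫ = 0 := by
  rw [inner_eq_integral_mul]
  exact integral_eq_zero_of_ae h

lemma posPart_nonneg (ψ : Lp ℝ 2 μ) : 0 ≤ Lp.posPart ψ := by
  rw [← Lp.coeFn_nonneg]
  filter_upwards [Lp.coeFn_posPart ψ] with x hx
  rw [hx]
  exact le_max_right _ _

lemma negPart_nonneg (ψ : Lp ℝ 2 μ) : 0 ≤ Lp.negPart ψ := by
  rw [← Lp.coeFn_nonneg]
  filter_upwards [Lp.coeFn_negPart ψ] with x hx
  rw [hx]
  simp

lemma posPart_sub_negPart (ψ : Lp ℝ 2 μ) : Lp.posPart ψ - Lp.negPart ψ = ψ := by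
  refine Lp.ext ?_
  filter_upwards [Lp.coeFn_sub (Lp.posPart ψ) (Lp.negPart ψ), Lp.coeFn_posPart ψ,
    Lp.coeFn_negPart ψ] with x h1 h2 h3
  rw [h1, Pi.sub_apply, h2, h3, sub_neg_eq_add, max_add_min, add_zero]

lemma nonneg_of_inner_nonneg {ψ : Lp ℝ 2 μ} (h : ∀ φ : Lp ℝ 2 μ, 0 ≤ φ → 0 ≤ ⟪ψ, φ⟫) :
    0 ≤ ψ := by
  have horth : ⟪Lp.posPart ψ, Lp.negPart ψ⟫ = 0 := by
    refine inner_eq_zero_of_mul_ae_eq_zero ?_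
    filter_upwards [Lp.coeFn_posPart ψ, Lp.coeFn_negPart ψ] with x h2 h3
    rw [h2, h3]
    rcases le_total (ψ x) 0 with h0 | h0 <;> simp [h0]
  have h1 := h _ (negPart_nonneg ψ)
  nth_rw 1 [← posPart_sub_negPart ψ] at h1
  rw [inner_sub_left, horth, real_inner_self_eq_norm_sq] at h1
  have h2 : ‖Lp.negPart ψ‖ = 0 := by nlinarith [norm_nonneg (Lp.negPart ψ)]
  have h3 := posPart_sub_negPart ψ
  rw [norm_eq_zero.1 h2, sub_zero] at h3
  rw [← h3]
  exact posPart_nonneg ψ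

/-- A nonnegative element whose null functionals are exactly those of a whole orbit. -/
lemma exists_orbit_sum {S : ℝ → Lp ℝ 2 μ →L[ℝ] Lp ℝ 2 μ} {f : Lp ℝ 2 μ}
    (hright : ∀ t ∈ Ioi (0 : ℝ), Tendsto (fun s => S s f) (𝓝[>] t) (𝓝 (S t f)))
    (hnonneg : ∀ t ∈ Ioi (0 : ℝ), 0 ≤ S t f) :
    ∃ e : Lp ℝ 2 μ, 0 ≤ e ∧ ∀ φ : Lp ℝ 2 μ, 0 ≤ φ →
      (⟪φ, e⟫ = 0 ↔ ∀ t ∈ Ioi (0 : ℝ), ⟪φ, S t f⟫ = 0) := by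
  obtain ⟨ε, hε, c, hεc, -⟩ := posSumOfEncodable one_pos {q : ℚ // 0 < q}
  set w : {q : ℚ // 0 < q} → Lp ℝ 2 μ := fun q => S (q : ℚ) f with hw
  have hqpos : ∀ q : {q : ℚ // 0 < q}, ((q : ℚ) : ℝ) ∈ Ioi (0 : ℝ) := fun q =>
    mem_Ioi.2 (Rat.cast_pos.2 q.2)
  have hw0 : ∀ q, 0 ≤ w q := fun q => hnonneg _ (hqpos q)
  set b : {q : ℚ // 0 < q} → ℝ := fun q => ε q / (1 + ‖w q‖) with hb
  have hb0 : ∀ q, 0 < b q := fun q => div_pos (hε q) (by positivity)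
  have hsum : Summable fun q => b q • w q := by
    refine Summable.of_norm_bounded hεc.summable fun q => ?_
    rw [norm_smul, Real.norm_of_nonneg (hb0 q).le, hb, div_mul_eq_mul_div]
    refine div_le_of_le_mul₀ (by positivity) (hε q).le ?_
    exact mul_le_mul_of_nonneg_left (by linarith) (hε q).le
  have hterm : ∀ q, 0 ≤ b q • w q := fun q => by
    rw [← Lp.coeFn_nonneg]
    filter_upwards [Lp.coeFn_smul (b q) (w q), (Lp.coeFn_nonneg _).2 (hw0 q)] with x h1 h2
    rw [h1]
    exact mul_nonneg (hb0 q).le h2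
  refine ⟨∑' q, b q • w q, tsum_nonneg hterm, fun φ hφ => ?_⟩
  have hinner : HasSum (fun q => b q * ⟪φ, w q⟫) ⟪φ, ∑' q, b q • w q⟫ := by
    simpa [real_inner_smul_right] using (innerSL ℝ φ).hasSum hsum.hasSum
  constructor
  · intro h t ht
    rw [h] at hinner
    have hzero : ∀ q, ⟪φ, w q⟫ = 0 := fun q => by
      have := (hasSum_zero_iff_of_nonneg fun q =>
        mul_nonneg (hb0 q).le (inner_nonneg_of_nonneg hφ (hw0 q))).1 hinner
      exact (mul_eq_zero.1 (congr_fun this q)).resolve_left (hb0 q).ne'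
    by_contra hne
    have hlim : Tendsto (fun s => ⟪φ, S s f⟫) (𝓝[>] t) (𝓝 ⟪φ, S t f⟫) :=
      tendsto_const_nhds.inner (hright t ht)
    obtain ⟨s, hts, hs⟩ := mem_nhdsGT_iff_exists_Ioo_subset.1 (hlim.eventually_ne hne)
    obtain ⟨q, hq1, hq2⟩ := exists_rat_btwn (mem_Ioi.1 hts)
    exact hs ⟨hq1, hq2⟩ (hzero ⟨q, Rat.cast_pos.1 ((mem_Ioi.1 ht).trans hq1)⟩)
  · intro h
    refine hinner.unique ?_
    simp only [hw, h _ (hqpos _), mul_zero]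
    exact hasSum_zero

/-- The band generated by a nonnegative element, and the associated band projection. -/
lemma starProjection_band_ae_eq {e : Lp ℝ 2 μ} (he : 0 ≤ e) {B : Set Ω} (hB : MeasurableSet B)
    (hBe : ∀ x, x ∈ B ↔ e x ≠ 0) (u : Lp ℝ 2 μ) :
    ⇑((Submodule.span ℝ {φ : Lp ℝ 2 μ | 0 ≤ φ ∧ ⟪φ, e⟫ = 0})ᗮ.starProjection u)
      =ᵐ[μ] B.indicator u := by
  have hmem : MemLp (B.indicator u) 2 μ := (Lp.memLp u).indicator hB
  have hy : ⇑hmem.toLp =ᵐ[μ] B.indicator u := hmem.coeFn_toLp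
  suffices h : (Submodule.span ℝ {φ : Lp ℝ 2 μ | 0 ≤ φ ∧ ⟪φ, e⟫ = 0})ᗮ.starProjection u =
      hmem.toLp by rwa [h]
  refine Submodule.eq_starProjection_of_mem_orthogonal ?_ ?_
  · refine mem_orthogonal_span.2 fun φ hφ => inner_eq_zero_of_mul_ae_eq_zero ?_
    filter_upwards [hy, mul_ae_eq_zero_of_inner_eq_zero hφ.1 he hφ.2] with x h1 h2
    rw [h1]
    by_cases hx : x ∈ B
    · simp [(mul_eq_zero.1 h2).resolve_right ((hBe x).1 hx)]
    · simp [hx]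
  · refine Submodule.le_orthogonal_orthogonal _ ?_
    have hz : ∀ᵐ x ∂μ, (u - hmem.toLp) x * e x = 0 := by
      filter_upwards [Lp.coeFn_sub u hmem.toLp, hy] with x h1 h2
      rw [h1, Pi.sub_apply, h2]
      by_cases hx : x ∈ B
      · simp [hx]
      · simp [not_not.1 (mt (hBe x).2 hx)]
    rw [← posPart_sub_negPart (u - hmem.toLp)]
    refine Submodule.sub_mem _ (Submodule.subset_span ⟨posPart_nonneg _, ?_⟩)
      (Submodule.subset_span ⟨negPart_nonneg _, ?_⟩)
    · refine inner_eq_zero_of_mul_ae_eq_zero ?_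
      filter_upwards [hz, Lp.coeFn_posPart (u - hmem.toLp)] with x h1 h2
      rcases mul_eq_zero.1 h1 with h | h
      · rw [h2, h]
        simp
      · rw [h, mul_zero]
    · refine inner_eq_zero_of_mul_ae_eq_zero ?_
      filter_upwards [hz, Lp.coeFn_negPart (u - hmem.toLp)] with x h1 h2
      rcases mul_eq_zero.1 h1 with h | h
      · rw [h2, h]
        simp
      · rw [h, mul_zero]

end L2

end ClosedForm

/-- **irreducibility criterion.** Let `(a, V)` be a closed form on
`H = L²(Ω, μ)` with associated `C₀`-semigroup `S`, and assume `S` is positive.  If for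
each measurable set `B ⊆ Ω` the invariance condition `𝟙_B V ⊆ V` forces `μ B = 0` or
`μ (Ω \ B) = 0`, then `S` is irreducible. -/
theorem statement14
    {Ω : Type*} [MeasurableSpace Ω] (μ : Measure Ω) [SigmaFinite μ]
    {V : Type*} [NormedAddCommGroup V] [InnerProductSpace ℝ V] [CompleteSpace V]
    (ι : V →L[ℝ] Lp ℝ 2 μ) (hinj : Function.Injective ⇑ι) (hdense : DenseRange ⇑ι)
    (a : V →ₗ[ℝ] V →ₗ[ℝ] ℝ)
    (hcont : ∃ M : ℝ, ∀ u v : V, |a u v| ≤ M * ‖u‖ * ‖v‖)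
    (hell : ∃ ω : ℝ, 0 ≤ ω ∧ ∃ α : ℝ, 0 < α ∧
      ∀ u : V, α * ‖u‖ ^ 2 ≤ a u u + ω * ‖ι u‖ ^ 2)
    (S : ℝ → Lp ℝ 2 μ →L[ℝ] Lp ℝ 2 μ)
    (hsg : ∀ s ∈ Ioi (0 : ℝ), ∀ t ∈ Ioi (0 : ℝ), S (s + t) = (S t).comp (S s))
    (hloc : ∃ C : ℝ, ∀ t ∈ Ioc (0 : ℝ) 1, ‖S t‖ ≤ C)
    (hc0 : ∀ f : Lp ℝ 2 μ, Tendsto (fun t : ℝ => S t f) (𝓝[>] (0 : ℝ)) (𝓝 f))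
    (hgen : ∀ x g : Lp ℝ 2 μ,
      Tendsto (fun t : ℝ => t⁻¹ • (S t x - x)) (𝓝[>] (0 : ℝ)) (𝓝 g) ↔
        ∃ u : V, ι u = x ∧ ∀ v : V, a u v = -⟪g, ι v⟫)
    -- `S` is positive:
    (hpos : ∀ t ∈ Ioi (0 : ℝ), ∀ f : Lp ℝ 2 μ, 0 ≤ f → 0 ≤ S t f)
    -- `𝟙_B V ⊆ V` implies that `B` or its complement is null:
    (hinv : ∀ B : Set Ω, MeasurableSet B →
      (∀ u : V, ∃ w : V, ⇑(ι w) =ᵐ[μ] B.indicator ⇑(ι u)) →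
      μ B = 0 ∨ μ Bᶜ = 0) :
    -- `S` is irreducible:
    ∀ f : Lp ℝ 2 μ, 0 ≤ f → f ≠ 0 → ∀ g : Lp ℝ 2 μ, 0 ≤ g → g ≠ 0 →
      ∃ t ∈ Ioi (0 : ℝ), 0 < ⟪g, S t f⟫ := by
  intro f hf hf0 g hg hg0
  by_contra! hcon
  have hgS : ∀ t ∈ Ioi (0 : ℝ), ⟪g, S t f⟫ = 0 := fun t ht =>
    le_antisymm (hcon t ht) (ClosedForm.inner_nonneg_of_nonneg hg (hpos t ht f hf))
  obtain ⟨e, he, hnull⟩ := ClosedForm.exists_orbit_sum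
    (fun t ht => ClosedForm.tendsto_orbit_nhdsGT hsg hc0 ht f) (fun t ht => hpos t ht f hf)
  set B : Set Ω := {x | e x ≠ 0} with hBdef
  have hB : MeasurableSet B := (Lp.stronglyMeasurable e).measurable (measurableSet_singleton 0).compl
  set N : Set (Lp ℝ 2 μ) := {φ | 0 ≤ φ ∧ ⟪φ, e⟫ = 0} with hN
  have hNS : ∀ t ∈ Ioi (0 : ℝ), ∀ φ ∈ N, ContinuousLinearMap.adjoint (S t) φ ∈ N := by
    rintro t ht φ ⟨hφ, hφe⟩
    have hadj : 0 ≤ ContinuousLinearMap.adjoint (S t) φ :=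
      ClosedForm.nonneg_of_inner_nonneg fun ψ hψ => by
        rw [ContinuousLinearMap.adjoint_inner_left]
        exact ClosedForm.inner_nonneg_of_nonneg hφ (hpos t ht ψ hψ)
    refine ⟨hadj, (hnull _ hadj).2 fun s hs => ?_⟩
    rw [ContinuousLinearMap.adjoint_inner_left, ← ContinuousLinearMap.comp_apply, ← hsg s hs t ht]
    exact (hnull φ hφ).1 hφe _ (mem_Ioi.2 (add_pos hs ht))
  have hK : ∀ t ∈ Ioi (0 : ℝ), ∀ h ∈ (Submodule.span ℝ N)ᗮ, S t h ∈ (Submodule.span ℝ N)ᗮ := by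
    intro t ht h hh
    refine ClosedForm.mem_orthogonal_span.2 fun φ hφ => ?_
    rw [← ContinuousLinearMap.adjoint_inner_left]
    exact ClosedForm.mem_orthogonal_span.1 hh _ (hNS t ht φ hφ)
  have hBV : ∀ u : V, ∃ w : V, ⇑(ι w) =ᵐ[μ] B.indicator ⇑(ι u) := by
    intro u
    obtain ⟨w, hw⟩ := ClosedForm.exists_eq_starProjection_of_invariant ι a hcont hell hsg hloc hc0
      hgen (Submodule.span ℝ N)ᗮ hK u
    exact ⟨w, hw ▸ ClosedForm.starProjection_band_ae_eq he hB (fun _ => Iff.rfl) (ι u)⟩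
  rcases hinv B hB hBV with h | h
  · have he0 : ∀ᵐ x ∂μ, e x = 0 := by
      simpa [hBdef] using measure_eq_zero_iff_ae_notMem.1 h
    have hfe : ⟪f, e⟫ = 0 := ClosedForm.inner_eq_zero_of_mul_ae_eq_zero
      (he0.mono fun x hx => by rw [hx, mul_zero])
    have hlim : Tendsto (fun t => ⟪f, S t f⟫) (𝓝[>] 0) (𝓝 ⟪f, f⟫) :=
      tendsto_const_nhds.inner (hc0 f)
    refine hf0 (inner_self_eq_zero (𝕜 := ℝ).1
      (tendsto_nhds_unique hlim (tendsto_const_nhds.congr' ?_)))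
    filter_upwards [self_mem_nhdsWithin] with t ht using ((hnull f hf).1 hfe t ht).symm
  · have he0 : ∀ᵐ x ∂μ, e x ≠ 0 := by
      simpa [hBdef] using measure_eq_zero_iff_ae_notMem.1 h
    refine hg0 (Lp.eq_zero_iff_ae_eq_zero.2 ?_)
    filter_upwards [he0,
      ClosedForm.mul_ae_eq_zero_of_inner_eq_zero hg he ((hnull g hg).2 hgS)] with x h1 h2
    exact (mul_eq_zero.1 h2).resolve_right h1
end
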